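/- For all n ≥ 1, j(n) = 2·∑_{m ≥ 1, m² ≤ n} (-1)^{m+1} j(n - m²). -/

import Mathlib

/-- A 01-partition: a finite sequence of non-negative integers whose last entry is ≥ 1,
satisfying the weakly decreasing conditions `n_j ≥ n_{j+1} - 1` and `n_j ≥ n_{j+2}`. -/
def Is01 (l : List ℕ) : Prop :=
  (∀ i, i + 1 < l.length → l[i + 1]! ≤ l[i]! + 1) ∧
  (∀ i, i + 2 < l.length → l[i + 2]! ≤ l[i]!) ∧
  (l ≠ [] → 1 ≤ l.getLast!)

/-- `j01 n` is the number of 01-partitions of `n` (with `j01 0 = 1`, the empty sequence). -/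
noncomputable def j01 (n : ℕ) : ℕ := Nat.card {l : List ℕ // Is01 l ∧ l.sum = n}

open Finset PowerSeries

/-- `Jagged x y l` says that `l` is a 01-partition that still satisfies the weakly decreasing
conditions of 01-partitions when preceded by the entries `x, y`. -/
def Jagged : ℕ → ℕ → List ℕ → Prop
  | _, _, [] => True
  | x, y, a :: t => a ≤ x ∧ a ≤ y + 1 ∧ (t = [] → 1 ≤ a) ∧ Jagged y a t

theorem is01_cons (a : ℕ) (t : List ℕ) :
    Is01 (a :: t) ↔ Is01 t ∧ (0 < t.length → t[0]! ≤ a + 1) ∧ (1 < t.length → t[1]! ≤ a) ∧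
      (t = [] → 1 ≤ a) := by
  constructor
  · rintro ⟨h1, h2, h3⟩
    refine ⟨⟨fun i hi => ?_, fun i hi => ?_, fun ht => ?_⟩, fun ht => ?_, fun ht => ?_, ?_⟩
    · simpa using h1 (i + 1) (by simpa using hi)
    · simpa using h2 (i + 1) (by rw [List.length_cons]; omega)
    · cases t with
      | nil => exact absurd rfl ht
      | cons b t => simpa [List.getLast!] using h3
    · simpa using h1 0 (by simpa using ht)
    · simpa using h2 0 (by rw [List.length_cons]; omega)
    · rintro rfl
      simpa [List.getLast!] using h3
  · rintro ⟨⟨h1, h2, h3⟩, h4, h5, h6⟩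
    refine ⟨fun i hi => ?_, fun i hi => ?_, fun _ => ?_⟩
    · cases i with
      | zero => simpa using h4 (by simpa using hi)
      | succ i => simpa using h1 i (by simpa using hi)
    · cases i with
      | zero => simpa using h5 (by rw [List.length_cons] at hi; omega)
      | succ i => simpa using h2 i (by rw [List.length_cons] at hi; omega)
    · cases t with
      | nil => simpa [List.getLast!] using h6
      | cons b t => simpa [List.getLast!] using h3

theorem jagged_iff_is01 (x y : ℕ) (l : List ℕ) :
    Jagged x y l ↔ Is01 l ∧ (0 < l.length → l[0]! ≤ x ∧ l[0]! ≤ y + 1) ∧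
      (1 < l.length → l[1]! ≤ y) := by
  induction l generalizing x y with
  | nil => simp [Jagged, Is01]
  | cons a t ih =>
    rw [Jagged, ih, is01_cons]
    simp only [List.length_cons, Nat.zero_lt_succ, forall_true_left, List.getElem!_cons_zero,
      List.getElem!_cons_succ, Nat.lt_add_left_iff_pos]
    tauto

theorem jagged_iff_is01_of_sum_le {x y : ℕ} {l : List ℕ} (hx : l.sum ≤ x) (hy : l.sum ≤ y) :
    Jagged x y l ↔ Is01 l := by
  rw [jagged_iff_is01, and_iff_left]
  have key : ∀ i, i < l.length → l[i]! ≤ l.sum := fun i hi => by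
    rw [getElem!_pos l i hi]
    exact List.le_sum_of_mem (List.getElem_mem hi)
  exact ⟨fun h => ⟨(key 0 h).trans hx, (key 0 h).trans (hy.trans (Nat.le_succ y))⟩,
    fun h => (key 1 h).trans hy⟩

/-- The `c`-th block: `[a, a + 1]` for `c = 2 * a`, and `[a + 1]` for `c = 2 * a + 1`.
Every 01-partition is uniquely a concatenation of blocks with weakly decreasing indices. -/
def block (c : ℕ) : List ℕ := if Even c then [c / 2, c / 2 + 1] else [c / 2 + 1]

theorem block_sum_pos (c : ℕ) : 0 < (block c).sum := by
  unfold block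
  split_ifs <;> simp

theorem block_even (a : ℕ) : block (2 * a) = [a, a + 1] := by
  simp [block]

theorem block_odd (a : ℕ) : block (2 * a + 1) = [a + 1] := by
  have : (2 * a + 1) / 2 = a := by omega
  simp [block, this]

/-- The 01-partitions of `n` all of whose blocks have index less than `M`. -/
def boundedJagged (M n : ℕ) : Set (List ℕ) :=
  {l | Jagged (M / 2) ((M + 1) / 2) l ∧ l.sum = n}

theorem jagged_succ_iff (M : ℕ) (l : List ℕ) :
    Jagged ((M + 1) / 2) ((M + 2) / 2) l ↔ Jagged (M / 2) ((M + 1) / 2) l ∨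
      ∃ t, Jagged ((M + 1) / 2) ((M + 2) / 2) t ∧ block M ++ t = l := by
  obtain ⟨a, rfl | rfl⟩ := Nat.even_or_odd' M
  · have h1 : (2 * a + 1) / 2 = a := by omega
    have h2 : (2 * a + 2) / 2 = a + 1 := by omega
    have h3 : 2 * a / 2 = a := by omega
    rw [h1, h2, h3, block_even]
    rcases l with _ | ⟨b, _ | ⟨c, t⟩⟩
    · simp [Jagged]
    · simp [Jagged]; omega
    · simp only [Jagged, List.cons_append, List.nil_append, List.cons.injEq]
      constructor
      · rintro ⟨h1, h2, h3, h4, h5, h6, h7⟩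
        by_cases h : c ≤ a
        · exact Or.inl ⟨h1, by omega, h3, h, h5, h6, h7⟩
        · obtain rfl : c = a + 1 := by omega
          obtain rfl : b = a := by omega
          exact Or.inr ⟨t, h7, rfl, rfl, rfl⟩
      · rintro (⟨h1, h2, h3, h4, h5, h6, h7⟩ | ⟨t, h, rfl, rfl, rfl⟩)
        · exact ⟨h1, by omega, h3, by omega, h5, h6, h7⟩
        · exact ⟨by omega, by omega, by simp, by omega, by omega, by simp, h⟩
  · have h1 : (2 * a + 1) / 2 = a := by omega
    have h2 : (2 * a + 1 + 1) / 2 = a + 1 := by omega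
    have h3 : (2 * a + 1 + 2) / 2 = a + 1 := by omega
    rw [h1, h2, h3, block_odd]
    rcases l with _ | ⟨b, t⟩
    · simp [Jagged]
    · simp only [Jagged, List.cons_append, List.nil_append, List.cons.injEq]
      constructor
      · rintro ⟨h1, h2, h3, h4⟩
        by_cases h : b ≤ a
        · exact Or.inl ⟨h, h2, h3, h4⟩
        · obtain rfl : b = a + 1 := by omega
          exact Or.inr ⟨t, h4, rfl, rfl⟩
      · rintro (⟨h1, h2, h3, h4⟩ | ⟨t, h, rfl, rfl⟩)
        · exact ⟨by omega, h2, h3, h4⟩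
        · exact ⟨by omega, by omega, by simp, h⟩

theorem not_jagged_block_append (M : ℕ) (t : List ℕ) :
    ¬ Jagged (M / 2) ((M + 1) / 2) (block M ++ t) := by
  obtain ⟨a, rfl | rfl⟩ := Nat.even_or_odd' M
  · rw [block_even]
    simp only [Jagged, List.cons_append, List.nil_append]
    omega
  · rw [block_odd]
    simp only [Jagged, List.cons_append, List.nil_append]
    omega

theorem boundedJagged_zero (n : ℕ) : boundedJagged 0 n = if n = 0 then {[]} else ∅ := by
  have key : ∀ l, Jagged 0 0 l ↔ l = [] := by
    refine fun l => ⟨fun h => ?_, ?_⟩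
    · induction l with
      | nil => rfl
      | cons a t ih =>
        obtain ⟨h1, -, h3, h4⟩ := h
        obtain rfl : a = 0 := by omega
        exact absurd (h3 (ih h4)) (by omega)
    · rintro rfl
      trivial
  ext l
  split_ifs with hn
  · simp only [boundedJagged, Set.mem_ofPred_eq, Set.mem_singleton_iff, Nat.zero_div, zero_add,
      Nat.reduceDiv, key]
    constructor
    · exact fun h => h.1
    · rintro rfl
      exact ⟨rfl, hn.symm⟩
  · simp only [boundedJagged, Set.mem_ofPred_eq, Set.mem_empty_iff_false, iff_false, Nat.zero_div,
      zero_add, Nat.reduceDiv, key]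
    rintro ⟨rfl, h⟩
    exact hn h.symm

theorem boundedJagged_succ_of_lt {M n : ℕ} (h : n < (block M).sum) :
    boundedJagged (M + 1) n = boundedJagged M n := by
  ext l
  simp only [boundedJagged, Set.mem_ofPred_eq, jagged_succ_iff M l]
  constructor
  · rintro ⟨h1 | ⟨t, -, rfl⟩, h2⟩
    · exact ⟨h1, h2⟩
    · rw [List.sum_append] at h2
      omega
  · exact fun ⟨h1, h2⟩ => ⟨Or.inl h1, h2⟩

theorem boundedJagged_succ_add (M n : ℕ) :
    boundedJagged (M + 1) (n + (block M).sum) =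
      boundedJagged M (n + (block M).sum) ∪ (block M ++ ·) '' boundedJagged (M + 1) n := by
  ext l
  simp only [boundedJagged, Set.mem_ofPred_eq, jagged_succ_iff M l, Set.mem_union, Set.mem_image]
  constructor
  · rintro ⟨h1 | ⟨t, ht, rfl⟩, h2⟩
    · exact Or.inl ⟨h1, h2⟩
    · rw [List.sum_append] at h2
      exact Or.inr ⟨t, ⟨ht, by omega⟩, rfl⟩
  · rintro (⟨h1, h2⟩ | ⟨t, ⟨ht, h2⟩, rfl⟩)
    · exact ⟨Or.inl h1, h2⟩
    · exact ⟨Or.inr ⟨t, ht, rfl⟩, by rw [List.sum_append, h2, add_comm]⟩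

theorem boundedJagged_finite (M n : ℕ) : (boundedJagged M n).Finite := by
  induction M generalizing n with
  | zero =>
    rw [boundedJagged_zero]
    split_ifs <;> simp
  | succ M ihM =>
    induction n using Nat.strong_induction_on with
    | _ n ihn =>
      rcases lt_or_ge n (block M).sum with h | h
      · rw [boundedJagged_succ_of_lt h]
        exact ihM n
      · obtain ⟨k, rfl⟩ := Nat.exists_eq_add_of_le' h
        rw [boundedJagged_succ_add]
        exact (ihM _).union ((ihn k (Nat.lt_add_of_pos_right (block_sum_pos M))).image _)

theorem ncard_boundedJagged_succ_add (M n : ℕ) :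
    (boundedJagged (M + 1) (n + (block M).sum)).ncard =
      (boundedJagged M (n + (block M).sum)).ncard + (boundedJagged (M + 1) n).ncard := by
  rw [boundedJagged_succ_add, Set.ncard_union_eq _ (boundedJagged_finite _ _)
    ((boundedJagged_finite _ _).image _), Set.ncard_image_of_injective _ (List.append_right_injective _)]
  rw [Set.disjoint_left]
  rintro _ h ⟨t, -, rfl⟩
  exact not_jagged_block_append M t h.1

theorem ncard_boundedJagged_eq_j01 {M n : ℕ} (h : 2 * n ≤ M) :
    (boundedJagged M n).ncard = j01 n := by
  rw [j01, ← Nat.card_coe_set_eq]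
  congr! 3 with l
  simp only [boundedJagged, Set.mem_ofPred_eq]
  exact and_congr_left fun hl => jagged_iff_is01_of_sum_le (by omega) (by omega)

/-- The generating function of 01-partitions all of whose blocks have index less than `M`. -/
noncomputable def jaggedSeries (M : ℕ) : ℤ⟦X⟧ := mk fun n => ((boundedJagged M n).ncard : ℤ)

theorem jaggedSeries_zero : jaggedSeries 0 = 1 := by
  ext n
  rw [jaggedSeries, coeff_mk, boundedJagged_zero, coeff_one]
  split_ifs <;> simp

theorem jaggedSeries_succ (M : ℕ) :
    jaggedSeries (M + 1) * (1 - X ^ (block M).sum) = jaggedSeries M := by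
  ext n
  rw [mul_sub, mul_one, map_sub, coeff_mul_X_pow']
  simp only [jaggedSeries, coeff_mk]
  split_ifs with h
  · obtain ⟨k, rfl⟩ := Nat.exists_eq_add_of_le' h
    rw [ncard_boundedJagged_succ_add, Nat.add_sub_cancel]
    push_cast
    ring
  · rw [boundedJagged_succ_of_lt (not_le.mp h), sub_zero]

theorem jaggedSeries_mul_prod (N : ℕ) :
    jaggedSeries (2 * N) *
      ((∏ k ∈ range N, (1 - X ^ (k + 1))) * ∏ k ∈ range N, (1 - X ^ (2 * k + 1))) = 1 := by
  induction N with
  | zero => simp [jaggedSeries_zero]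
  | succ N ih =>
    have h1 := jaggedSeries_succ (2 * N)
    have h2 := jaggedSeries_succ (2 * N + 1)
    simp only [block_even, block_odd, List.sum_cons, List.sum_nil] at h1 h2
    rw [← h1, ← h2] at ih
    rw [prod_range_succ, prod_range_succ]
    linear_combination ih

section QSeries

variable {R : Type*} [CommRing R]

/-- A fraction-free form of a finite identity of Shanks, which refines Gauss's product for
`∑ (-1) ^ m * q ^ m ^ 2`. -/
theorem prod_mul_sum_neg_one_pow_mul_pow_sq (q : R) (n : ℕ) :
    (∏ k ∈ range n, (1 + q ^ (k + 1))) * (1 + 2 * ∑ m ∈ Icc 1 n, (-1) ^ m * q ^ m ^ 2) =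
      ∑ s ∈ range (n + 1), (-1) ^ s * q ^ (s * (n + 1)) * (∏ k ∈ Ico s n, (1 - q ^ (k + 1))) *
        ∏ i ∈ range s, (1 + q ^ i) := by
  induction n with
  | zero => simp
  | succ n ih =>
    have partial_sum : ∀ t ≤ n, ∑ s ∈ range (t + 1),
        ((-1) ^ s * q ^ (s * (n + 1 + 1)) * (∏ k ∈ Ico s (n + 1), (1 - q ^ (k + 1))) *
          (∏ i ∈ range s, (1 + q ^ i)) - (1 + q ^ (n + 1)) *
        ((-1) ^ s * q ^ (s * (n + 1)) * (∏ k ∈ Ico s n, (1 - q ^ (k + 1))) *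
          ∏ i ∈ range s, (1 + q ^ i))) =
        (-1) ^ (t + 1) * q ^ ((t + 1) * (n + 1)) * (∏ k ∈ Ico t n, (1 - q ^ (k + 1))) *
          ∏ i ∈ range (t + 1), (1 + q ^ i) := by
      intro t ht
      induction t with
      | zero =>
        rw [sum_range_one, prod_Ico_succ_top (Nat.zero_le n)]
        simp only [zero_mul, pow_zero, prod_range_zero, prod_range_one, zero_add, one_mul]
        ring
      | succ t iht =>
        rw [sum_range_succ, iht (by omega), prod_Ico_succ_top ht, prod_range_succ _ (t + 1),
          prod_eq_prod_Ico_succ_bot ht]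
        ring
    have boundary : (∏ i ∈ range (n + 1), (1 + q ^ i)) = 2 * ∏ k ∈ range n, (1 + q ^ (k + 1)) := by
      rw [prod_range_succ']
      ring
    have h := partial_sum n le_rfl
    rw [sum_sub_distrib, ← mul_sum, ← ih, sub_eq_iff_eq_add] at h
    rw [sum_range_succ, h, ← insert_Icc_right_eq_Icc_add_one (by omega), sum_insert (by simp),
      prod_range_succ _ n, boundary]
    simp only [Ico_self, prod_empty]
    ring

theorem prod_one_sub_mul_prod_odd_mul_prod_one_add (q : R) (n : ℕ) :
    (∏ k ∈ range n, (1 - q ^ (k + 1))) * ((∏ k ∈ range n, (1 - q ^ (2 * k + 1))) *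
      ∏ k ∈ range n, (1 + q ^ (k + 1))) = ∏ k ∈ range (2 * n), (1 - q ^ (k + 1)) := by
  induction n with
  | zero => simp
  | succ n ih =>
    rw [Nat.mul_succ, prod_range_succ _ (2 * n + 1), prod_range_succ _ (2 * n), ← ih,
      prod_range_succ, prod_range_succ, prod_range_succ]
    ring

theorem dvd_prod_one_sub_sub_one {ι : Type*} (d : R) (s : Finset ι) (f : ι → R)
    (h : ∀ i ∈ s, d ∣ f i) : d ∣ (∏ i ∈ s, (1 - f i)) - 1 := by
  classical
  induction s using Finset.induction_on with
  | empty => simp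
  | insert i s hi ih =>
    have h1 := ih fun j hj => h j (mem_insert_of_mem hj)
    have h2 := h i (mem_insert_self i s)
    rw [prod_insert hi]
    convert dvd_sub h1 (h2.mul_right (∏ i ∈ s, (1 - f i))) using 1
    ring

end QSeries

theorem X_pow_dvd_prod_odd_mul_prod_one_add_sub_one (n : ℕ) :
    (X : ℤ⟦X⟧) ^ (n + 1) ∣ (∏ k ∈ range n, (1 - X ^ (2 * k + 1))) *
      (∏ k ∈ range n, (1 + X ^ (k + 1))) - 1 := by
  have hne : (∏ k ∈ range n, (1 - X ^ (k + 1)) : ℤ⟦X⟧) ≠ 0 :=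
    right_ne_zero_of_mul_eq_one (a := jaggedSeries (2 * n) *
      ∏ k ∈ range n, (1 - X ^ (2 * k + 1))) (by
        linear_combination jaggedSeries_mul_prod n)
  have h := prod_one_sub_mul_prod_odd_mul_prod_one_add (X : ℤ⟦X⟧) n
  rw [← prod_range_mul_prod_Ico _ (show n ≤ 2 * n by omega)] at h
  rw [mul_left_cancel₀ hne h]
  exact dvd_prod_one_sub_sub_one _ _ _ fun k hk =>
    pow_dvd_pow X (Nat.succ_le_succ (mem_Ico.mp hk).1)

theorem X_pow_dvd_jaggedSeries_mul_sub_one (n : ℕ) :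
    (X : ℤ⟦X⟧) ^ (n + 1) ∣
      jaggedSeries (2 * n) * (1 + 2 * ∑ m ∈ Icc 1 n, (-1) ^ m * X ^ m ^ 2) - 1 := by
  have hJ := jaggedSeries_mul_prod n
  have hEuler := X_pow_dvd_prod_odd_mul_prod_one_add_sub_one n
  have hShanks : (X : ℤ⟦X⟧) ^ (n + 1) ∣ (∏ k ∈ range n, (1 + X ^ (k + 1))) *
      (1 + 2 * ∑ m ∈ Icc 1 n, (-1) ^ m * X ^ m ^ 2) - ∏ k ∈ range n, (1 - X ^ (k + 1)) := by
    rw [prod_mul_sum_neg_one_pow_mul_pow_sq, sum_range_succ']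
    simp only [pow_zero, zero_mul, one_mul, range_zero, prod_empty, mul_one, ← range_eq_Ico,
      add_sub_cancel_right]
    refine dvd_sum fun s _ => ?_
    have : (X : ℤ⟦X⟧) ^ (n + 1) ∣ X ^ ((s + 1) * (n + 1)) :=
      pow_dvd_pow X (Nat.le_mul_of_pos_left _ s.succ_pos)
    exact ((this.mul_left _).mul_right _).mul_right _
  generalize (1 + 2 * ∑ m ∈ Icc 1 n, (-1) ^ m * X ^ m ^ 2 : ℤ⟦X⟧) = θ at *
  generalize (∏ k ∈ range n, (1 + X ^ (k + 1)) : ℤ⟦X⟧) = B at *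
  generalize (∏ k ∈ range n, (1 - X ^ (k + 1)) : ℤ⟦X⟧) = A at *
  generalize (∏ k ∈ range n, (1 - X ^ (2 * k + 1)) : ℤ⟦X⟧) = O at *
  convert dvd_sub (hShanks.mul_left (jaggedSeries (2 * n) * O))
    (hEuler.mul_left (jaggedSeries (2 * n) * θ)) using 1
  linear_combination hJ

/-- Recurrence: `j(n) = 2 ∑_{m ≥ 1, m² ≤ n} (-1)^{m+1} j(n - m²)` for `n ≥ 1`. -/
theorem jagged_recurrence (n : ℕ) (hn : 1 ≤ n) :
    (j01 n : ℤ) = 2 * ∑ m ∈ (Finset.Icc 1 n).filter (fun m => m ^ 2 ≤ n),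
      (-1) ^ (m + 1) * (j01 (n - m ^ 2) : ℤ) := by
  have h := X_pow_dvd_iff.mp (X_pow_dvd_jaggedSeries_mul_sub_one n) n (Nat.lt_succ_self n)
  have coeff_term : ∀ m, coeff n (jaggedSeries (2 * n) * ((-1) ^ m * X ^ m ^ 2)) =
      if m ^ 2 ≤ n then (-1) ^ m * (j01 (n - m ^ 2) : ℤ) else 0 := by
    intro m
    have : jaggedSeries (2 * n) * ((-1) ^ m * X ^ m ^ 2) =
        C ((-1) ^ m) * (jaggedSeries (2 * n) * X ^ m ^ 2) := by
      simp only [map_pow, map_neg, map_one]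
      ring
    rw [this, coeff_C_mul, coeff_mul_X_pow', mul_ite, mul_zero]
    simp only [jaggedSeries, coeff_mk]
    rw [ncard_boundedJagged_eq_j01 (by omega)]
  have expand : jaggedSeries (2 * n) * (1 + 2 * ∑ m ∈ Icc 1 n, (-1) ^ m * X ^ m ^ 2) - 1 =
      jaggedSeries (2 * n) + C 2 *
        ∑ m ∈ Icc 1 n, jaggedSeries (2 * n) * ((-1) ^ m * X ^ m ^ 2) - 1 := by
    rw [← mul_sum, map_ofNat]
    ring
  rw [expand, map_sub, map_add, coeff_C_mul, map_sum, sum_congr rfl fun m _ => coeff_term m,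
    coeff_one, if_neg (by omega), jaggedSeries, coeff_mk, ncard_boundedJagged_eq_j01 le_rfl,
    ← sum_filter] at h
  simp only [pow_succ, mul_neg_one, neg_mul, sum_neg_distrib] at h ⊢
  linear_combination h
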